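/- Let H be an infinite-dimensional separable complex Hilbert space, let p, q ∈ [1,∞] with 1/p + 1/q = 1, let C ∈ B^p(H) and T ∈ B^q(H). If C is normal and its eigenvalues all lie on a single line through the origin of the complex plane (or if T is normal with this collinearity property), then the closure of W_C(T) is convex. -/

import Mathlib

open Filter
open scoped InnerProductSpace ENNReal

/-- The rank-one operator `x ↦ ⟪f, x⟫ • g`. -/
noncomputable def rankOne {H : Type*} [NormedAddCommGroup H] [InnerProductSpace ℂ H]
    (f g : H) : H →L[ℂ] H :=
  (innerSL ℂ f).smulRight g

/-- The `n`-th singular value (`0`-indexed) of an operator, defined as its distance (in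
operator norm) to the operators of rank at most `n`; for compact operators this coincides with
the `(n+1)`-st coefficient of a Schmidt decomposition. -/
noncomputable def sv {H : Type*} [NormedAddCommGroup H] [InnerProductSpace ℂ H]
    (T : H →L[ℂ] H) (n : ℕ) : ℝ :=
  ⨅ (u : Fin n → H) (v : Fin n → H), ‖T - ∑ i, rankOne (u i) (v i)‖

/-- Membership in the `p`-th Schatten class `B^p(H)`, `p ∈ [1,∞]`:  compact and, if `p ≠ ∞`,
`p`-summable singular values. -/
def MemSchatten {H : Type*} [NormedAddCommGroup H] [InnerProductSpace ℂ H]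
    (p : ℝ≥0∞) (T : H →L[ℂ] H) : Prop :=
  IsCompactOperator T ∧ (p ≠ ∞ → Summable fun n => sv T n ^ p.toReal)

/-- The Schatten `p`-norm `ν_p`. -/
noncomputable def schattenNorm {H : Type*} [NormedAddCommGroup H] [InnerProductSpace ℂ H]
    (p : ℝ≥0∞) (T : H →L[ℂ] H) : ℝ :=
  if p = ∞ then ‖T‖ else (∑' n, sv T n ^ p.toReal) ^ (1 / p.toReal)

/-- The trace of an operator computed along the orthonormal basis `b`; for trace-class
operators this is basis-independent. -/
noncomputable def traceAlong {H : Type*} [NormedAddCommGroup H] [InnerProductSpace ℂ H]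
    [CompleteSpace H] (b : HilbertBasis ℕ ℂ H) (A : H →L[ℂ] H) : ℂ :=
  ∑' i, ⟪(b i : H), A (b i)⟫_ℂ

/-- The `C`-numerical range `W_C(T) = { tr(C U† T U) | U unitary }`. -/
def cNumRange {H : Type*} [NormedAddCommGroup H] [InnerProductSpace ℂ H]
    [CompleteSpace H] (b : HilbertBasis ℕ ℂ H) (C T : H →L[ℂ] H) : Set ℂ :=
  {z | ∃ U ∈ unitary (H →L[ℂ] H), z = traceAlong b (C * star U * T * U)}

/-- The eigenvalues of `A` all lie on a single line through the origin of `ℂ`. -/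
def EigsCollinearThroughOrigin {H : Type*} [NormedAddCommGroup H] [InnerProductSpace ℂ H]
    (A : H →L[ℂ] H) : Prop :=
  ∃ d : ℂ, ∀ lam : ℂ, (∃ v : H, v ≠ 0 ∧ A v = lam • v) → ∃ t : ℝ, lam = (t : ℂ) * d

lemma exists_unit_real (a b : ℂ) : ∃ w : ℂ, (starRingEnd ℂ) w * w = 1 ∧ ∃ κ : ℝ, w * a + (starRingEnd ℂ) w * b = κ := by
  by_cases h : a - (starRingEnd ℂ) b = 0
  · refine ⟨1, by simp, (a+b).re, ?_⟩
    have : a = (starRingEnd ℂ) b := sub_eq_zero.1 h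
    subst this
    apply Complex.ext <;> simp
  · set z := a - (starRingEnd ℂ) b with hz
    have hn : (‖z‖ : ℂ) ≠ 0 := by simpa using h
    have hzz : (starRingEnd ℂ) z * z = (‖z‖:ℂ)^2 := Complex.conj_mul' z
    refine ⟨(starRingEnd ℂ) z / ‖z‖, ?_, ?_⟩
    · simp only [map_div₀, Complex.conj_conj, Complex.conj_ofReal]
      field_simp
      rw [mul_comm, hzz]
    · refine ⟨((starRingEnd ℂ) z / ‖z‖ * a + (starRingEnd ℂ) ((starRingEnd ℂ) z / ‖z‖) * b).re, ?_⟩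
      rw [eq_comm, ← Complex.conj_eq_iff_re]
      have ha : a = z + (starRingEnd ℂ) b := by rw [hz]; ring
      rw [ha]
      simp only [map_div₀, Complex.conj_conj, Complex.conj_ofReal, map_add, map_mul]
      field_simp
      ring

lemma exists_angle (κ t : ℝ) (h0 : 0 ≤ t) (h1 : t ≤ 1) :
    ∃ c s : ℝ, c^2 + s^2 = 1 ∧ (s^2 - t) + c * s * κ = 0 := by
  have := intermediate_value_Icc (a := 0) (b := Real.pi/2) (by positivity)
    (f := fun θ => (Real.sin θ ^2 - t) + Real.cos θ * Real.sin θ * κ) (by fun_prop)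
  have h := this (show (0:ℝ) ∈ _ by simp [h0, h1])
  obtain ⟨θ, _, h⟩ := h
  exact ⟨Real.cos θ, Real.sin θ, by simp, h⟩

lemma toeplitz_step {E : Type*} [NormedAddCommGroup E] [InnerProductSpace ℂ E] (T : E →ₗ[ℂ] E)
    (f1 f2 : E) (h1 : ⟪f1, f1⟫_ℂ = 1) (h2 : ⟪f2, f2⟫_ℂ = 1) (h12 : ⟪f1, f2⟫_ℂ = 0) (t : ℝ)
    (t0 : 0 ≤ t) (t1 : t ≤ 1) :
    ∃ g1 g2 : E, ⟪g1, g1⟫_ℂ = 1 ∧ ⟪g2, g2⟫_ℂ = 1 ∧ ⟪g1, g2⟫_ℂ = 0 ∧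
      (∀ w, ⟪f1, w⟫_ℂ = 0 → ⟪f2, w⟫_ℂ = 0 → ⟪g1, w⟫_ℂ = 0 ∧ ⟪g2, w⟫_ℂ = 0) ∧
      ⟪g1, T g1⟫_ℂ = (1 - t) * ⟪f1, T f1⟫_ℂ + t * ⟪f2, T f2⟫_ℂ ∧
      ⟪g2, T g2⟫_ℂ = t * ⟪f1, T f1⟫_ℂ + (1 - t) * ⟪f2, T f2⟫_ℂ := by
  have h21 : ⟪f2, f1⟫_ℂ = 0 := by rw [← inner_conj_symm, h12]; simp
  set x := ⟪f1, T f1⟫_ℂ with hx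
  set y := ⟪f2, T f2⟫_ℂ with hy
  set m := ⟪f1, T f2⟫_ℂ with hm
  set n := ⟪f2, T f1⟫_ℂ with hn
  obtain ⟨c, s, w, hcs, hw, hk⟩ : ∃ c s : ℝ, ∃ w : ℂ, (c:ℂ)^2 + (s:ℂ)^2 = 1 ∧ (starRingEnd ℂ) w * w = 1 ∧
      ((s:ℂ)^2 - t) * (y - x) + c * s * (w * m + (starRingEnd ℂ) w * n) = 0 := by
    by_cases hd : y - x = 0
    · exact ⟨1, 0, 1, by simp, by simp, by simp [hd]⟩
    obtain ⟨w, hw, κ, hκ⟩ := exists_unit_real (m / (y - x)) (n / (y - x))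
    obtain ⟨c, s, hcs, h⟩ := exists_angle κ t t0 t1
    refine ⟨c, s, w, by exact_mod_cast hcs, hw, ?_⟩
    have e : w * m + (starRingEnd ℂ) w * n = κ * (y - x) := by
      rw [← hκ]; field_simp
    rw [e]
    have h' : ((s:ℂ)^2 - t) + c * s * κ = 0 := by exact_mod_cast h
    linear_combination (y - x) * h'
  refine ⟨(c:ℂ) • f1 + ((s:ℂ) * w) • f2, (-((s:ℂ) * (starRingEnd ℂ) w)) • f1 + (c:ℂ) • f2, ?_, ?_, ?_, ?_, ?_, ?_⟩
  · simp only [inner_add_left, inner_add_right, inner_smul_left, inner_smul_right, h1, h2, h12, h21, map_mul, map_neg, Complex.conj_ofReal, Complex.conj_conj]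
    linear_combination hcs + s^2 * hw
  · simp only [inner_add_left, inner_add_right, inner_smul_left, inner_smul_right, h1, h2, h12, h21, map_mul, map_neg, Complex.conj_ofReal, Complex.conj_conj]
    linear_combination hcs + s^2 * hw
  · simp only [inner_add_left, inner_add_right, inner_smul_left, inner_smul_right, h1, h2, h12, h21, map_mul, map_neg, Complex.conj_ofReal, Complex.conj_conj]
    ring
  · intro v hv1 hv2
    simp [inner_add_left, inner_smul_left, hv1, hv2]
  · simp only [map_add, map_smul, inner_add_left, inner_add_right, inner_smul_left, inner_smul_right, map_mul, map_neg, Complex.conj_ofReal, Complex.conj_conj, ← hx, ← hy, ← hm, ← hn]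
    linear_combination hk + s^2 * y * hw + x * hcs
  · simp only [map_add, map_smul, inner_add_left, inner_add_right, inner_smul_left, inner_smul_right, map_mul, map_neg, Complex.conj_ofReal, Complex.conj_conj, ← hx, ← hy, ← hm, ← hn]
    linear_combination -hk + s^2 * x * hw + y * hcs

lemma family_step {E : Type*} [NormedAddCommGroup E] [InnerProductSpace ℂ E] (T : E →ₗ[ℂ] E)
    {N : ℕ} (f : Fin N → E) (hf : Orthonormal ℂ f) (j k : Fin N) (hjk : j ≠ k) (t : ℝ)
    (t0 : 0 ≤ t) (t1 : t ≤ 1) :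
    ∃ g : Fin N → E, Orthonormal ℂ g ∧ (∀ i, i ≠ j → i ≠ k → g i = f i) ∧
      ⟪g j, T (g j)⟫_ℂ = (1 - t) * ⟪f j, T (f j)⟫_ℂ + t * ⟪f k, T (f k)⟫_ℂ ∧
      ⟪g k, T (g k)⟫_ℂ = t * ⟪f j, T (f j)⟫_ℂ + (1 - t) * ⟪f k, T (f k)⟫_ℂ := by
  have hf' := orthonormal_iff_ite.1 hf
  obtain ⟨g1, g2, e1, e2, e12, ew, eT1, eT2⟩ := toeplitz_step T (f j) (f k) (by rw [hf']; simp)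
    (by rw [hf']; simp) (by simp [hf', hjk]) t t0 t1
  have e21 : ⟪g2, g1⟫_ℂ = 0 := by rw [← inner_conj_symm, e12]; simp
  have hw : ∀ i, i ≠ j → i ≠ k → ⟪g1, f i⟫_ℂ = 0 ∧ ⟪g2, f i⟫_ℂ = 0 := fun i hi hk =>
    ew _ (by simp [hf', hi.symm]) (by simp [hf', hk.symm])
  have hw' : ∀ i, i ≠ j → i ≠ k → ⟪f i, g1⟫_ℂ = 0 ∧ ⟪f i, g2⟫_ℂ = 0 := fun i hi hk => by
    rw [← inner_conj_symm, (hw i hi hk).1, ← inner_conj_symm, (hw i hi hk).2]; simp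
  refine ⟨fun i => if i = j then g1 else if i = k then g2 else f i, ?_, ?_, ?_, ?_⟩
  · rw [orthonormal_iff_ite]
    intro a b
    by_cases aj : a = j <;> by_cases ak : a = k <;> by_cases bj : b = j <;> by_cases bk : b = k <;>
      simp_all <;> grind
  · intro i hi hk
    simp [hi, hk]
  · simpa using eT1
  · simpa [hjk.symm] using eT2

lemma hlp {E : Type*} [NormedAddCommGroup E] [InnerProductSpace ℂ E] (T : E →ₗ[ℂ] E)
    {N : ℕ} (a : Fin N → ℝ) (ha : Antitone a) (f : Fin N → E) (hf : Orthonormal ℂ f) (m : ℕ) :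
    ∀ (c : Fin N → ℝ) (_ : ∀ k, ∑ i ∈ Finset.Iic k, a i ≤ ∑ i ∈ Finset.Iic k, c i)
      (_ : ∑ i, a i = ∑ i, c i) (_ : (Finset.univ.filter fun i => a i ≠ c i).card ≤ m),
    ∃ g : Fin N → E, Orthonormal ℂ g ∧
      ∑ i, (c i : ℂ) * ⟪g i, T (g i)⟫_ℂ = ∑ i, (a i : ℂ) * ⟪f i, T (f i)⟫_ℂ := by
  induction m with
  | zero =>
    intro c _ _ h
    have h' : ∀ i, a i = c i := by
      simpa [Finset.filter_eq_empty_iff] using h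
    exact ⟨f, hf, by simp [h']⟩
  | succ m ih =>
    intro c hpre htot hcard
    by_cases hac : ∀ i, a i = c i
    · exact ⟨f, hf, by simp [hac]⟩
    have hk : ∃ k, c k < a k := by
      by_contra! hcon
      apply hac
      have := (Finset.sum_eq_sum_iff_of_le (s := Finset.univ) (fun i _ => hcon i)).1 htot
      exact fun i => this i (Finset.mem_univ i)
    obtain ⟨k, hk, hkmin⟩ := (wellFounded_lt (α := Fin N)).has_min {k | c k < a k} hk
    have hk : c k < a k := hk
    have hmin : ∀ i, i < k → a i ≤ c i := fun i hi => by
      by_contra! hcon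
      exact hkmin i hcon hi
    have hj : ∃ j, j < k ∧ a j < c j := by
      by_contra! hcon
      have : ∑ i ∈ Finset.Iic k, c i < ∑ i ∈ Finset.Iic k, a i := by
        apply Finset.sum_lt_sum
        · intro i hi
          rcases (Finset.mem_Iic.1 hi).lt_or_eq with h | h
          · exact hcon i h
          · rw [h]; exact hk.le
        · exact ⟨k, by simp, hk⟩
      exact absurd (hpre k) (not_le.2 this)
    obtain ⟨j, hjk, hj⟩ := hj
    have hne : j ≠ k := hjk.ne
    set δ := min (c j - a j) (a k - c k) with hδ
    have hδ0 : 0 < δ := lt_min (by linarith) (by linarith)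
    have hδ1 : δ ≤ c j - a j := min_le_left _ _
    have hδ2 : δ ≤ a k - c k := min_le_right _ _
    have hajk : a k ≤ a j := ha hjk.le
    set c' : Fin N → ℝ := fun i => c i + (if i = j then -δ else 0) + (if i = k then δ else 0) with hc'
    have hsum : ∀ s : Finset (Fin N), ∑ i ∈ s, c' i = ∑ i ∈ s, c i + (if j ∈ s then -δ else 0) + (if k ∈ s then δ else 0) := by
      intro s
      simp [hc', Finset.sum_add_distrib, Finset.sum_ite_eq']
    have hcj : c' j = c j - δ := by simp [hc', hne]; ring
    have hck : c' k = c k + δ := by simp [hc', hne.symm]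
    have hco : ∀ i, i ≠ j → i ≠ k → c' i = c i := fun i h1 h2 => by simp [hc', h1, h2]
    obtain ⟨g, hg, hgs⟩ := ih c' (by
      intro m
      rw [hsum]
      have hm := hpre m
      by_cases hjm : j ≤ m
      · by_cases hkm : k ≤ m
        · simp [hjm, hkm]; linarith
        · have : c j - a j ≤ ∑ i ∈ Finset.Iic m, (c i - a i) :=
            Finset.single_le_sum (f := fun i => c i - a i) (fun i hi => by
              have := hmin i (lt_of_le_of_lt (Finset.mem_Iic.1 hi) (not_le.1 hkm))
              linarith) (Finset.mem_Iic.2 hjm)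
          rw [Finset.sum_sub_distrib] at this
          simp [hjm, hkm]; linarith
      · have hkm : ¬ k ≤ m := fun h => hjm (hjk.le.trans h)
        simp [hjm, hkm]; linarith) (by rw [hsum]; simp [htot]) (by
      apply Nat.le_of_lt_succ
      refine lt_of_lt_of_le (Finset.card_lt_card ?_) hcard
      rw [Finset.ssubset_iff_of_subset]
      · rcases min_choice (c j - a j) (a k - c k) with h | h
        · refine ⟨j, by simp [hj.ne], ?_⟩
          simp only [Finset.mem_filter, hcj, hδ, h]; simp
        · refine ⟨k, by simp [hk.ne'], ?_⟩
          simp only [Finset.mem_filter, hck, hδ, h]; simp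
      · intro i hi
        simp only [Finset.mem_filter, Finset.mem_univ, true_and] at hi ⊢
        by_cases h1 : i = j
        · rw [h1]; exact hj.ne
        by_cases h2 : i = k
        · rw [h2]; exact hk.ne'
        rwa [hco i h1 h2] at hi)
    have hpos : 0 < c j - c k := by linarith
    obtain ⟨g', hg', hgo, hgj, hgk⟩ := family_step T g hg j k hne (δ / (c j - c k)) (by positivity)
      (by rw [div_le_one hpos]; linarith)
    refine ⟨g', hg', ?_⟩
    rw [← hgs]
    have hjmem : j ∈ Finset.univ.erase k := by simp [hne]
    rw [← Finset.add_sum_erase _ _ (Finset.mem_univ k), ← Finset.add_sum_erase _ _ hjmem,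
      ← Finset.add_sum_erase Finset.univ _ (Finset.mem_univ k), ← Finset.add_sum_erase _ (fun i => (c' i:ℂ) * _) hjmem]
    have hrest : ∑ i ∈ (Finset.univ.erase k).erase j, (c i : ℂ) * ⟪g' i, T (g' i)⟫_ℂ =
        ∑ i ∈ (Finset.univ.erase k).erase j, (c' i : ℂ) * ⟪g i, T (g i)⟫_ℂ := by
      apply Finset.sum_congr rfl
      intro i hi
      simp only [Finset.mem_erase] at hi
      rw [hgo i hi.1 hi.2.1, hco i hi.1 hi.2.1]
    rw [hrest, hgj, hgk, hcj, hck]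
    have hne0 : (c j : ℂ) - c k ≠ 0 := by exact_mod_cast hpos.ne'
    push_cast
    field_simp
    ring

lemma prefix_le {N : ℕ} (c : Fin N → ℝ) (hc : Antitone c) (D : Fin N → Fin N → ℝ) (hD : ∀ i j, 0 ≤ D i j)
    (hr : ∀ i, ∑ j, D i j = 1) (hcol : ∀ j, ∑ i, D i j = 1) (k : Fin N) :
    ∑ i ∈ Finset.Iic k, ∑ j, D i j * c j ≤ ∑ i ∈ Finset.Iic k, c i := by
  set w : Fin N → ℝ := fun j => ∑ i ∈ Finset.Iic k, D i j with hw
  have hw1 : ∀ j, w j ≤ 1 := fun j => by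
    rw [← hcol j]
    exact Finset.sum_le_sum_of_subset_of_nonneg (Finset.subset_univ _) (fun i _ _ => hD i j)
  have hw0 : ∀ j, 0 ≤ w j := fun j => Finset.sum_nonneg (fun i _ => hD i j)
  have hws : ∑ j, w j = ∑ j, (if j ≤ k then (1:ℝ) else 0) := by
    simp only [hw]
    rw [Finset.sum_comm]
    simp only [hr]
    rw [Finset.sum_ite]
    simp only [Finset.sum_const_zero, add_zero]
    congr 1
    ext; simp
  have e1 : ∑ i ∈ Finset.Iic k, ∑ j, D i j * c j = ∑ j, w j * c j := by
    rw [Finset.sum_comm]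
    simp only [hw, Finset.sum_mul]
  have e2 : ∑ i ∈ Finset.Iic k, c i = ∑ j, (if j ≤ k then (1:ℝ) else 0) * c j := by
    simp only [ite_mul, one_mul, zero_mul]
    rw [Finset.sum_ite]
    simp only [Finset.sum_const_zero, add_zero]
    congr 1
    ext; simp
  rw [e1, e2]
  have : 0 ≤ ∑ j, ((if j ≤ k then (1:ℝ) else 0) - w j) * (c j - c k) := by
    apply Finset.sum_nonneg
    intro j _
    by_cases hj : j ≤ k
    · simp only [hj, if_true]
      exact mul_nonneg (by linarith [hw1 j]) (by linarith [hc hj])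
    · simp only [hj, if_false]
      have := hc (not_le.1 hj).le
      nlinarith [hw0 j]
  simp only [sub_mul, mul_sub, Finset.sum_sub_distrib, ← Finset.sum_mul, hws] at this
  linarith

lemma majorize {E : Type*} [NormedAddCommGroup E] [InnerProductSpace ℂ E] (T : E →ₗ[ℂ] E)
    {N : ℕ} (a c : Fin N → ℝ) (f : Fin N → E) (hf : Orthonormal ℂ f)
    (D : Fin N → Fin N → ℝ) (hD : ∀ i j, 0 ≤ D i j)
    (hr : ∀ i, ∑ j, D i j = 1) (hcol : ∀ j, ∑ i, D i j = 1) (hac : ∀ i, a i = ∑ j, D i j * c j) :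
    ∃ g : Fin N → E, Orthonormal ℂ g ∧
      ∑ i, (c i : ℂ) * ⟪g i, T (g i)⟫_ℂ = ∑ i, (a i : ℂ) * ⟪f i, T (f i)⟫_ℂ := by
  obtain ⟨σ, hσ⟩ : ∃ σ : Equiv.Perm (Fin N), Antitone (a ∘ σ) :=
    ⟨Tuple.sort (fun i => - a i), fun i j h => neg_le_neg_iff.1 (Tuple.monotone_sort (fun i => - a i) h)⟩
  obtain ⟨τ, hτ⟩ : ∃ τ : Equiv.Perm (Fin N), Antitone (c ∘ τ) :=
    ⟨Tuple.sort (fun i => - c i), fun i j h => neg_le_neg_iff.1 (Tuple.monotone_sort (fun i => - c i) h)⟩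
  have hac' : ∀ i, (a ∘ σ) i = ∑ j, D (σ i) (τ j) * (c ∘ τ) j := fun i => by
    simp only [Function.comp, hac]
    exact (Equiv.sum_comp τ (fun j => D (σ i) j * c j)).symm
  obtain ⟨g, hg, h⟩ := hlp T (a ∘ σ) hσ (f ∘ σ) (hf.comp _ σ.injective) _ (c ∘ τ) (by
    intro k
    simp only [hac']
    exact prefix_le (c ∘ τ) hτ (fun i j => D (σ i) (τ j)) (fun i j => hD _ _)
      (fun i => by rw [Equiv.sum_comp τ (fun j => D (σ i) j)]; exact hr _)
      (fun j => by rw [Equiv.sum_comp σ (fun i => D i (τ j))]; exact hcol _) k) (by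
    simp only [Function.comp]
    rw [Equiv.sum_comp σ, Equiv.sum_comp τ]
    simp only [hac]
    rw [Finset.sum_comm]
    simp only [← Finset.sum_mul, hcol, one_mul]) le_rfl
  refine ⟨g ∘ τ.symm, hg.comp _ τ.symm.injective, ?_⟩
  rw [← Equiv.sum_comp σ (fun i => (a i : ℂ) * ⟪f i, T (f i)⟫_ℂ), ← Equiv.sum_comp τ]
  simpa using h

@[simp] lemma rankOne_apply' {H : Type*} [NormedAddCommGroup H] [InnerProductSpace ℂ H]
    (f g x : H) : rankOne f g x = ⟪f, x⟫_ℂ • g := by simp [rankOne]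

lemma fd_convex {E : Type*} [NormedAddCommGroup E] [InnerProductSpace ℂ E] [FiniteDimensional ℂ E]
    (T : E →ₗ[ℂ] E) {N : ℕ} (f g : OrthonormalBasis (Fin N) ℂ E) (c : Fin N → ℝ) (s t : ℝ)
    (hs : 0 ≤ s) (ht : 0 ≤ t) (hst : s + t = 1) :
    ∃ h : Fin N → E, Orthonormal ℂ h ∧ ∑ i, (c i : ℂ) * ⟪h i, T (h i)⟫_ℂ =
      s * (∑ i, (c i : ℂ) * ⟪f i, T (f i)⟫_ℂ) + t * (∑ i, (c i : ℂ) * ⟪g i, T (g i)⟫_ℂ) := by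
  set A : E →ₗ[ℂ] E := ∑ i, (c i : ℂ) • ((s:ℂ) • (rankOne (f i) (f i) : E →L[ℂ] E).toLinearMap +
    (t:ℂ) • (rankOne (g i) (g i) : E →L[ℂ] E).toLinearMap) with hA
  have hAx : ∀ x, A x = ∑ i, (c i : ℂ) • ((s:ℂ) • ⟪f i, x⟫_ℂ • f i + (t:ℂ) • ⟪g i, x⟫_ℂ • g i) := by
    intro x
    simp [hA, LinearMap.sum_apply]
  have hAxy : ∀ x y, ⟪x, A y⟫_ℂ = ∑ i, (c i : ℂ) * (s * (⟪f i, y⟫_ℂ * ⟪x, f i⟫_ℂ) + t * (⟪g i, y⟫_ℂ * ⟪x, g i⟫_ℂ)) := by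
    intro x y
    rw [hAx, inner_sum]
    simp only [inner_smul_right, inner_add_right]
  have hsym : A.IsSymmetric := by
    intro x y
    rw [← inner_conj_symm, hAxy, hAxy, map_sum]
    apply Finset.sum_congr rfl
    intro i _
    simp only [map_mul, map_add, Complex.conj_ofReal, inner_conj_symm]
    ring
  have hn : Module.finrank ℂ E = N := by simpa using Module.finrank_eq_card_basis f.toBasis
  set k := hsym.eigenvectorBasis hn
  set a := hsym.eigenvalues hn
  have hak : ∀ j, A (k j) = (a j : ℂ) • k j := fun j => hsym.apply_eigenvectorBasis hn j
  obtain ⟨h, hh, hsum⟩ := majorize T a c k k.orthonormal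
    (fun j i => s * ‖⟪f i, k j⟫_ℂ‖^2 + t * ‖⟪g i, k j⟫_ℂ‖^2) (fun i j => by positivity)
    (fun j => by
      rw [Finset.sum_add_distrib, ← Finset.mul_sum, ← Finset.mul_sum, f.sum_sq_norm_inner_right,
        g.sum_sq_norm_inner_right, k.norm_eq_one]
      simpa using hst)
    (fun j => by
      rw [Finset.sum_add_distrib, ← Finset.mul_sum, ← Finset.mul_sum, k.sum_sq_norm_inner_left,
        k.sum_sq_norm_inner_left, f.norm_eq_one, g.norm_eq_one]
      simpa using hst)
    (fun j => by
      have h1 : ((a j : ℝ) : ℂ) = ⟪k j, A (k j)⟫_ℂ := by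
        rw [hak, inner_smul_right, inner_self_eq_norm_sq_to_K, k.norm_eq_one]; simp
      rw [hAxy] at h1
      have : ((a j : ℝ) : ℂ) = ((∑ i, (s * ‖⟪f i, k j⟫_ℂ‖^2 + t * ‖⟪g i, k j⟫_ℂ‖^2) * c i : ℝ) : ℂ) := by
        rw [h1]
        push_cast
        apply Finset.sum_congr rfl
        intro i _
        rw [← inner_conj_symm (k j) (f i), ← inner_conj_symm (k j) (g i), Complex.mul_conj', Complex.mul_conj']
        ring
      exact_mod_cast this)
  refine ⟨h, hh, ?_⟩
  rw [hsum]
  have e : ∀ j, (a j : ℂ) * ⟪k j, T (k j)⟫_ℂ = ∑ i, (c i : ℂ) * (s * (⟪f i, k j⟫_ℂ * ⟪k j, T (f i)⟫_ℂ) + t * (⟪g i, k j⟫_ℂ * ⟪k j, T (g i)⟫_ℂ)) := by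
    intro j
    rw [← inner_smul_right, ← map_smul, ← hak, hAx, map_sum, inner_sum]
    simp only [map_smul, map_add, inner_smul_right, inner_add_right]
  simp only [e]
  rw [Finset.sum_comm]
  simp only [← Finset.mul_sum, Finset.sum_add_distrib, k.sum_inner_mul_inner]
  rw [Finset.mul_sum, Finset.mul_sum, ← Finset.sum_add_distrib]
  apply Finset.sum_congr rfl
  intro i _
  ring

/-- extension of finite orthonormal family inside finite dim subspace -/
lemma ext_family {H : Type*} [NormedAddCommGroup H] [InnerProductSpace ℂ H] {n : ℕ} (K : Submodule ℂ H)
    [FiniteDimensional ℂ K] (f : Fin n → H) (hf : Orthonormal ℂ f) (hK : ∀ i, f i ∈ K)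
    (hn : n ≤ Module.finrank ℂ K) :
    ∃ B : OrthonormalBasis (Fin (Module.finrank ℂ K)) ℂ K, ∀ i, (B (Fin.castLE hn i) : H) = f i := by
  set v : Fin (Module.finrank ℂ K) → K := fun i => if h : (i:ℕ) < n then ⟨f ⟨i, h⟩, hK _⟩ else 0 with hv
  obtain ⟨B, hB⟩ := Orthonormal.exists_orthonormalBasis_extension_of_card_eq (𝕜 := ℂ) (E := K) (ι := Fin (Module.finrank ℂ K))
    (by simp) (v := v) (s := {i | (i:ℕ) < n}) (by
      rw [orthonormal_iff_ite] at hf ⊢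
      rintro ⟨i, hi⟩ ⟨j, hj⟩
      simp only [Set.mem_ofPred_eq] at hi hj
      simp [hv, hi, hj, hf, Fin.ext_iff, Set.domRestrict])
  refine ⟨B, fun i => ?_⟩
  rw [hB _ (by simp)]
  simp [hv]

lemma le_finrank {H : Type*} [NormedAddCommGroup H] [InnerProductSpace ℂ H] {n : ℕ} (K : Submodule ℂ H)
    [FiniteDimensional ℂ K] (f : Fin n → H) (hf : Orthonormal ℂ f) (hK : ∀ i, f i ∈ K) :
    n ≤ Module.finrank ℂ K := by
  have h := hf.linearIndependent
  have h2 : LinearIndependent ℂ (fun i => (⟨f i, hK i⟩ : K)) :=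
    LinearIndependent.of_comp K.subtype h
  simpa using h2.fintype_card_le_finrank

lemma sum_castLE {M : Type*} [AddCommMonoid M] {n N : ℕ} (hn : n ≤ N) (F : Fin N → M)
    (h : ∀ i : Fin N, n ≤ (i:ℕ) → F i = 0) : ∑ i, F i = ∑ i : Fin n, F (Fin.castLE hn i) := by
  symm
  refine (Finset.sum_map Finset.univ (Fin.castLEEmb hn) F).symm.trans ?_
  apply Finset.sum_subset (Finset.subset_univ _)
  intro i _ hi
  apply h
  by_contra! hcon
  exact hi (Finset.mem_map.2 ⟨⟨i, hcon⟩, by simp, by ext; simp⟩)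

lemma on_convex {H : Type*} [NormedAddCommGroup H] [InnerProductSpace ℂ H] (T : H →L[ℂ] H)
    {n : ℕ} (f g : Fin n → H) (hf : Orthonormal ℂ f) (hg : Orthonormal ℂ g) (c : Fin n → ℝ) (s t : ℝ)
    (hs : 0 ≤ s) (ht : 0 ≤ t) (hst : s + t = 1) :
    ∃ h : Fin n → H, Orthonormal ℂ h ∧ ∑ i, (c i : ℂ) * ⟪h i, T (h i)⟫_ℂ =
      s * (∑ i, (c i : ℂ) * ⟪f i, T (f i)⟫_ℂ) + t * (∑ i, (c i : ℂ) * ⟪g i, T (g i)⟫_ℂ) := by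
  set K : Submodule ℂ H := Submodule.span ℂ (Set.range f ∪ Set.range g) with hKdef
  have : FiniteDimensional ℂ K := FiniteDimensional.span_of_finite ℂ
    ((Set.finite_range f).union (Set.finite_range g))
  have hfK : ∀ i, f i ∈ K := fun i => Submodule.subset_span (Or.inl ⟨i, rfl⟩)
  have hgK : ∀ i, g i ∈ K := fun i => Submodule.subset_span (Or.inr ⟨i, rfl⟩)
  have hn := le_finrank K f hf hfK
  obtain ⟨F, hF⟩ := ext_family K f hf hfK hn
  obtain ⟨G, hG⟩ := ext_family K g hg hgK hn
  set TK : K →ₗ[ℂ] K := (K.orthogonalProjectionOnto ∘L T ∘L K.subtypeL).toLinearMap with hTK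
  have hTKi : ∀ x y : K, ⟪x, TK y⟫_ℂ = ⟪(x:H), T y⟫_ℂ := by
    intro x y
    simp [hTK]
  set c' : Fin (Module.finrank ℂ K) → ℝ := fun i => if h : (i:ℕ) < n then c ⟨i, h⟩ else 0 with hc'
  obtain ⟨h, hh, hsum⟩ := fd_convex TK F G c' s t hs ht hst
  refine ⟨fun i => h (Fin.castLE hn i), ?_, ?_⟩
  · have := (hh.comp (Fin.castLE hn) (Fin.castLE_injective hn))
    rw [orthonormal_iff_ite] at this ⊢
    simpa using this
  · have hz : ∀ (L : Fin (Module.finrank ℂ K) → K), ∑ i, (c' i : ℂ) * ⟪L i, TK (L i)⟫_ℂ = ∑ i, (c i : ℂ) * ⟪(L (Fin.castLE hn i) : H), T (L (Fin.castLE hn i))⟫_ℂ := by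
      intro L
      rw [sum_castLE hn]
      · simp [hc', hTKi]
      · intro i hi
        simp [hc', not_lt.2 hi]
    rw [hz, hz, hz] at hsum
    simpa only [hF, hG] using hsum

lemma exists_unitary {H : Type*} [NormedAddCommGroup H] [InnerProductSpace ℂ H] [CompleteSpace H]
    {n : ℕ} (f g : Fin n → H) (hf : Orthonormal ℂ f) (hg : Orthonormal ℂ g) :
    ∃ U ∈ unitary (H →L[ℂ] H), ∀ i, U (f i) = g i := by
  set K : Submodule ℂ H := Submodule.span ℂ (Set.range f ∪ Set.range g) with hKdef
  have : FiniteDimensional ℂ K := FiniteDimensional.span_of_finite ℂ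
    ((Set.finite_range f).union (Set.finite_range g))
  have hfK : ∀ i, f i ∈ K := fun i => Submodule.subset_span (Or.inl ⟨i, rfl⟩)
  have hgK : ∀ i, g i ∈ K := fun i => Submodule.subset_span (Or.inr ⟨i, rfl⟩)
  have hn := le_finrank K f hf hfK
  obtain ⟨F, hF⟩ := ext_family K f hf hfK hn
  obtain ⟨G, hG⟩ := ext_family K g hg hgK hn
  set L : K ≃ₗᵢ[ℂ] K := F.equiv G (Equiv.refl _) with hL
  have hLF : ∀ i, L (F i) = G i := fun i => by simp [hL]
  let P := K.orthogonalProjectionOnto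
  let mk : (K ≃ₗᵢ[ℂ] K) → H →L[ℂ] H := fun M =>
    (ContinuousLinearMap.id ℂ H - K.subtypeL ∘L P) + K.subtypeL ∘L (M : K →L[ℂ] K) ∘L P
  have hmk : ∀ M x, mk M x = x - (P x : H) + (M (P x) : H) := fun M x => by simp [mk]
  have hPm : ∀ M x, P (mk M x) = M (P x) := by
    intro M x
    have hPP : ∀ y : K, P (y : H) = y := fun y => by simp [P]
    rw [hmk, map_add, map_sub, hPP, hPP]
    simp
  have hinv : ∀ M M' : K ≃ₗᵢ[ℂ] K, (∀ y, M' (M y) = y) → ∀ x, mk M' (mk M x) = x := by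
    intro M M' h x
    rw [hmk M', hPm, h, hmk]
    abel
  have hadj : ∀ M : K ≃ₗᵢ[ℂ] K, ∀ x y, ⟪mk M x, y⟫_ℂ = ⟪x, mk M.symm y⟫_ℂ := by
    intro M x y
    rw [hmk, hmk, inner_add_left, inner_add_right, inner_sub_left, inner_sub_right]
    have h1 : ⟪(M (P x) : H), y⟫_ℂ = ⟪M (P x), P y⟫_ℂ := by simp [P]
    have h2 : ⟪x, (M.symm (P y) : H)⟫_ℂ = ⟪P x, M.symm (P y)⟫_ℂ := by simp [P]
    have h3 : ⟪(P x : H), y⟫_ℂ = ⟪x, (P y : H)⟫_ℂ := by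
      exact Submodule.inner_starProjection_left_eq_right K x y
    rw [h1, h2, h3, LinearIsometryEquiv.inner_map_eq_flip]
  have hstar : star (mk L) = mk L.symm := by
    rw [ContinuousLinearMap.star_eq_adjoint, eq_comm, ContinuousLinearMap.eq_adjoint_iff]
    intro x y
    exact hadj L.symm x y
  refine ⟨mk L, ?_, ?_⟩
  · rw [Unitary.mem_iff, hstar]
    constructor <;> ext x
    · exact hinv L L.symm (by simp) x
    · exact hinv L.symm L (by simp) x
  · intro i
    rw [hmk]
    have : P (f i) = F (Fin.castLE hn i) := by
      rw [← hF]; simp [P]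
    rw [this, hLF, hF, hG]
    simp

section
variable {H : Type*} [NormedAddCommGroup H] [InnerProductSpace ℂ H]

def RankLE (R : H →L[ℂ] H) (n : ℕ) : Prop := ∃ u v : Fin n → H, R = ∑ i, rankOne (u i) (v i)

lemma RankLE.add {R S : H →L[ℂ] H} {n m : ℕ} (hR : RankLE R n) (hS : RankLE S m) :
    RankLE (R + S) (n + m) := by
  obtain ⟨u, v, rfl⟩ := hR
  obtain ⟨u', v', rfl⟩ := hS
  exact ⟨Fin.append u u', Fin.append v v', by simp [Fin.sum_univ_add]⟩

lemma rankLE_zero (n : ℕ) : RankLE (0 : H →L[ℂ] H) n :=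
  ⟨0, 0, by ext; simp⟩

lemma RankLE.mono {R : H →L[ℂ] H} {n m : ℕ} (hR : RankLE R n) (h : n ≤ m) : RankLE R m := by
  have := hR.add (rankLE_zero (m - n))
  rwa [add_zero, Nat.add_sub_cancel' h] at this

lemma RankLE.smul {R : H →L[ℂ] H} {n : ℕ} (hR : RankLE R n) (z : ℂ) : RankLE (z • R) n := by
  obtain ⟨u, v, rfl⟩ := hR
  refine ⟨u, fun i => z • v i, ?_⟩
  ext x
  simp [Finset.smul_sum, smul_comm z]

lemma RankLE.neg {R : H →L[ℂ] H} {n : ℕ} (hR : RankLE R n) : RankLE (-R) n := by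
  simpa using hR.smul (-1)

lemma RankLE.sub {R S : H →L[ℂ] H} {n m : ℕ} (hR : RankLE R n) (hS : RankLE S m) :
    RankLE (R - S) (n + m) := by
  rw [sub_eq_add_neg]; exact hR.add hS.neg

lemma RankLE.mul_left {R : H →L[ℂ] H} {n : ℕ} (hR : RankLE R n) (A : H →L[ℂ] H) : RankLE (A * R) n := by
  obtain ⟨u, v, rfl⟩ := hR
  refine ⟨u, fun i => A (v i), ?_⟩
  ext x
  simp

variable [CompleteSpace H]

lemma RankLE.mul_right {R : H →L[ℂ] H} {n : ℕ} (hR : RankLE R n) (A : H →L[ℂ] H) : RankLE (R * A) n := by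
  obtain ⟨u, v, rfl⟩ := hR
  refine ⟨fun i => ContinuousLinearMap.adjoint A (u i), v, ?_⟩
  ext x
  simp [ContinuousLinearMap.adjoint_inner_left]

lemma star_rankOne (u v : H) : star (rankOne u v) = rankOne v u := by
  rw [ContinuousLinearMap.star_eq_adjoint, eq_comm, ContinuousLinearMap.eq_adjoint_iff]
  intro x y
  simp [inner_smul_left, inner_smul_right, mul_comm]

lemma RankLE.star {R : H →L[ℂ] H} {n : ℕ} (hR : RankLE R n) : RankLE (star R) n := by
  obtain ⟨u, v, rfl⟩ := hR
  refine ⟨v, u, ?_⟩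
  rw [star_sum]
  simp [star_rankOne]

lemma RankLE.trace_bound (b : HilbertBasis ℕ ℂ H) {R : H →L[ℂ] H} {r : ℕ} (hR : RankLE R r) (F : Finset ℕ) :
    ∑ i ∈ F, ‖⟪b i, R (b i)⟫_ℂ‖ ≤ r * ‖R‖ := by
  obtain ⟨u, v, hRe⟩ := hR
  set S := Submodule.span ℂ (Set.range v)
  have hRS : ∀ x, R x ∈ S := fun x => by
    rw [hRe]
    simp only [sum_apply, rankOne_apply']
    exact Submodule.sum_mem _ (fun i _ => Submodule.smul_mem _ _ (Submodule.subset_span ⟨i, rfl⟩))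
  have hfd : FiniteDimensional ℂ S := FiniteDimensional.span_of_finite ℂ (Set.finite_range v)
  have hrk : Module.finrank ℂ S ≤ r := by
    refine (finrank_range_le_card (R := ℂ) v).trans ?_
    simp
  set s := stdOrthonormalBasis ℂ S
  have hsn : ∀ j, ‖(s j : H)‖ = 1 := fun j => s.norm_eq_one j
  have hx : ∀ x, R x = ∑ j, ⟪(s j : H), R x⟫_ℂ • (s j : H) := by
    intro x
    have := congrArg (Subtype.val) (s.sum_repr ⟨R x, hRS x⟩)
    simp only [OrthonormalBasis.repr_apply_apply, Submodule.coe_inner] at this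
    refine this.symm.trans ?_
    rw [Submodule.coe_sum]
    simp only [Submodule.coe_smul]
  have h1 : ∀ i, ‖⟪b i, R (b i)⟫_ℂ‖ ≤ ∑ j, ‖⟪b i, (s j : H)⟫_ℂ‖ * ‖⟪b i, ContinuousLinearMap.adjoint R (s j)⟫_ℂ‖ := by
    intro i
    conv_lhs => rw [hx (b i), inner_sum]
    refine (norm_sum_le _ _).trans (Finset.sum_le_sum fun j _ => ?_)
    rw [inner_smul_right, norm_mul, ← ContinuousLinearMap.adjoint_inner_left, norm_inner_symm, mul_comm]
  have bes : ∀ x, √(∑ i ∈ F, ‖⟪b i, x⟫_ℂ‖^2) ≤ ‖x‖ := fun x => by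
    apply Real.sqrt_le_iff.2 ⟨norm_nonneg _, ?_⟩
    exact b.orthonormal.sum_inner_products_le x
  calc _ ≤ ∑ i ∈ F, ∑ j, ‖⟪b i, (s j : H)⟫_ℂ‖ * ‖⟪b i, ContinuousLinearMap.adjoint R (s j)⟫_ℂ‖ :=
        Finset.sum_le_sum fun i _ => h1 i
    _ = ∑ j, ∑ i ∈ F, ‖⟪b i, (s j : H)⟫_ℂ‖ * ‖⟪b i, ContinuousLinearMap.adjoint R (s j)⟫_ℂ‖ := Finset.sum_comm
    _ ≤ ∑ j : Fin (Module.finrank ℂ S), ‖R‖ := by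
        apply Finset.sum_le_sum
        intro j _
        refine (Real.sum_mul_le_sqrt_mul_sqrt F _ _).trans ?_
        calc _ ≤ ‖(s j : H)‖ * ‖ContinuousLinearMap.adjoint R (s j)‖ :=
              mul_le_mul (bes _) (bes _) (Real.sqrt_nonneg _) (norm_nonneg _)
          _ ≤ ‖R‖ := by
              rw [hsn, one_mul]
              refine (ContinuousLinearMap.le_opNorm _ _).trans ?_
              rw [hsn, mul_one, LinearIsometryEquiv.norm_map]
    _ ≤ r * ‖R‖ := by
        simp only [Finset.sum_const, Finset.card_univ, Fintype.card_fin, nsmul_eq_mul]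
        gcongr

def Dom (X : H →L[ℂ] H) (σ : ℕ → ℝ) : Prop := ∀ n, ∃ R : H →L[ℂ] H, RankLE R n ∧ ‖X - R‖ ≤ σ n

lemma Dom.nonneg {X : H →L[ℂ] H} {σ : ℕ → ℝ} (h : Dom X σ) (n : ℕ) : 0 ≤ σ n := by
  obtain ⟨R, _, hR⟩ := h n
  exact (norm_nonneg _).trans hR

lemma Dom.norm_le {X : H →L[ℂ] H} {σ : ℕ → ℝ} (h : Dom X σ) : ‖X‖ ≤ σ 0 := by
  obtain ⟨R, ⟨u, v, hR⟩, h⟩ := h 0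
  simpa [hR] using h

lemma Dom.mono {X : H →L[ℂ] H} {σ τ : ℕ → ℝ} (h : Dom X σ) (hle : ∀ n, σ n ≤ τ n) : Dom X τ := fun n => by
  obtain ⟨R, h1, h2⟩ := h n
  exact ⟨R, h1, h2.trans (hle n)⟩

lemma Dom.mul {A B : H →L[ℂ] H} {α β : ℕ → ℝ} (hA : Dom A α) (hB : Dom B β) :
    Dom (A * B) (fun m => α (m / 2) * β (m / 2)) := by
  intro m
  obtain ⟨R, hR, hR'⟩ := hA (m / 2)
  obtain ⟨S, hS, hS'⟩ := hB (m / 2)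
  refine ⟨R * B + (A - R) * S, ((hR.mul_right B).add (hS.mul_left (A - R))).mono (by omega), ?_⟩
  have : A * B - (R * B + (A - R) * S) = (A - R) * (B - S) := by noncomm_ring
  rw [this]
  exact (norm_mul_le _ _).trans (mul_le_mul hR' hS' (norm_nonneg _) ((norm_nonneg _).trans hR'))

lemma unitary_norm_le {U : H →L[ℂ] H} (hU : U ∈ unitary (H →L[ℂ] H)) : ‖U‖ ≤ 1 := by
  apply ContinuousLinearMap.opNorm_le_bound _ zero_le_one
  intro x
  rw [one_mul]
  exact ((Unitary.linearIsometryEquiv ⟨U, hU⟩).norm_map x).le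

lemma Dom.conj {A : H →L[ℂ] H} {α : ℕ → ℝ} (hA : Dom A α) {U : H →L[ℂ] H} (hU : U ∈ unitary (H →L[ℂ] H)) :
    Dom (star U * A * U) α := by
  intro m
  obtain ⟨R, hR, hR'⟩ := hA m
  refine ⟨star U * R * U, (hR.mul_left _).mul_right _, ?_⟩
  have : star U * A * U - star U * R * U = star U * (A - R) * U := by noncomm_ring
  rw [this]
  have h1 := unitary_norm_le hU
  have h2 : ‖star U‖ ≤ 1 := by rwa [norm_star]
  calc _ ≤ ‖star U‖ * ‖A - R‖ * ‖U‖ := (norm_mul_le _ _).trans (by gcongr; exact norm_mul_le _ _)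
    _ ≤ 1 * ‖A - R‖ * 1 := by gcongr
    _ ≤ α m := by simpa using hR'

lemma Dom.sum_le (b : HilbertBasis ℕ ℂ H) {X : H →L[ℂ] H} {σ : ℕ → ℝ} (h : Dom X σ) (hσ : Antitone σ)
    (hs : Summable σ) (F : Finset ℕ) : ∑ i ∈ F, ‖⟪b i, X (b i)⟫_ℂ‖ ≤ 20 * ∑' n, σ n := by
  have h0 := h.nonneg
  choose R hR hR' using h
  set N : (H →L[ℂ] H) → ℝ := fun X => ∑ i ∈ F, ‖⟪b i, X (b i)⟫_ℂ‖ with hN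
  have hadd : ∀ A B, N (A + B) ≤ N A + N B := by
    intro A B
    simp only [hN]
    rw [← Finset.sum_add_distrib]
    refine Finset.sum_le_sum fun i _ => ?_
    simp only [add_apply, inner_add_right]
    exact norm_add_le _ _
  have hcard : ∀ A, N A ≤ F.card * ‖A‖ := by
    intro A
    rw [← nsmul_eq_mul]
    apply Finset.sum_le_card_nsmul
    intro i _
    refine (norm_inner_le_norm _ _).trans ?_
    rw [b.orthonormal.1 i, one_mul]
    simpa [b.orthonormal.1 i] using A.le_opNorm (b i)
  set Q : ℕ → H →L[ℂ] H := fun k => R (2 ^ k) with hQ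
  have hXn : ‖X‖ ≤ σ 0 := Dom.norm_le (fun n => ⟨R n, hR n, hR' n⟩)
  have hQ0 : N (Q 0) ≤ 2 * σ 0 := by
    have h1 : N (Q 0) ≤ (1:ℕ) * ‖Q 0‖ := (show RankLE (Q 0) 1 by simpa [hQ] using hR 1).trace_bound b F
    have h2 : ‖Q 0‖ ≤ ‖X‖ + ‖X - Q 0‖ := by
      have : Q 0 = X - (X - Q 0) := by abel
      conv_lhs => rw [this]
      exact norm_sub_le _ _
    have h3 : ‖X - Q 0‖ ≤ σ 1 := by simpa [hQ] using hR' 1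
    have h4 := hσ (zero_le_one (α := ℕ))
    push_cast at h1
    linarith
  have hQk : ∀ k, N (Q (k+1) - Q k) ≤ 6 * (2^k * σ (2^k)) := by
    intro k
    have h1 := ((hR (2^(k+1))).sub (hR (2^k))).trace_bound b F
    have h2 : ‖Q (k+1) - Q k‖ ≤ 2 * σ (2^k) := by
      have : Q (k+1) - Q k = (X - Q k) - (X - Q (k+1)) := by abel
      rw [this]
      have h3 := hR' (2^(k+1))
      have h4 := hR' (2^k)
      have h5 : σ (2^(k+1)) ≤ σ (2^k) := hσ (Nat.pow_le_pow_right (by norm_num) (by omega))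
      refine (norm_sub_le _ _).trans ?_
      simp only [hQ]
      linarith
    refine h1.trans ?_
    push_cast
    rw [pow_succ]
    calc _ = 3 * 2^k * ‖Q (k+1) - Q k‖ := by simp only [hQ]; ring
      _ ≤ 3 * 2^k * (2 * σ (2^k)) := by gcongr
      _ = _ := by ring
  have hind : ∀ n, N (Q n) ≤ 2 * σ 0 + 6 * ∑ k ∈ Finset.range n, 2^k * σ (2^k) := by
    intro n
    induction n with
    | zero => simpa using hQ0
    | succ n ih =>
      have := hadd (Q n) (Q (n+1) - Q n)
      rw [add_sub_cancel] at this
      rw [Finset.sum_range_succ]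
      linarith [hQk n]
  have hcond : ∀ n, ∑ k ∈ Finset.range n, 2^k * σ (2^k) ≤ 3 * ∑' n, σ n := by
    intro n
    have h1 := Finset.sum_condensed_le (f := σ) (fun m n _ h => hσ h) n
    have h2 : ∑ k ∈ Finset.range n, 2^k * σ (2^k) ≤ ∑ k ∈ Finset.range (n+1), 2^k * σ (2^k) := by
      rw [Finset.sum_range_succ]
      have := h0 (2^n)
      have : 0 ≤ 2^n * σ (2^n) := by positivity
      linarith
    have h3 : σ 1 ≤ ∑' n, σ n := hs.le_tsum 1 (fun j _ => h0 j)
    have h4 : ∑ k ∈ Finset.Ico 2 (2 ^ n + 1), σ k ≤ ∑' n, σ n := hs.sum_le_tsum _ (fun j _ => h0 j)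
    simp only [nsmul_eq_mul] at h1
    push_cast at h1
    linarith
  have hfin : ∀ n, N X ≤ 20 * (∑' n, σ n) + F.card * σ (2^n) := by
    intro n
    have h1 := hadd (Q n) (X - Q n)
    rw [add_sub_cancel] at h1
    have h2 := hcard (X - Q n)
    have h3 : (F.card : ℝ) * ‖X - Q n‖ ≤ F.card * σ (2^n) := by gcongr; exact hR' _
    have h4 : σ 0 ≤ ∑' n, σ n := hs.le_tsum 0 (fun j _ => h0 j)
    linarith [hind n, hcond n]
  have hlim : Tendsto (fun n => 20 * (∑' n, σ n) + F.card * σ (2^n)) atTop (nhds (20 * (∑' n, σ n) + F.card * 0)) := by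
    apply Tendsto.const_add
    apply Tendsto.const_mul
    exact hs.tendsto_atTop_zero.comp (tendsto_pow_atTop_atTop_of_one_lt (by norm_num))
  have := ge_of_tendsto' hlim hfin
  simpa using this

lemma Dom.summable (b : HilbertBasis ℕ ℂ H) {X : H →L[ℂ] H} {σ : ℕ → ℝ} (h : Dom X σ) (hσ : Antitone σ)
    (hs : Summable σ) : Summable (fun i => ⟪b i, X (b i)⟫_ℂ) ∧ ‖traceAlong b X‖ ≤ 20 * ∑' n, σ n := by
  have h1 : Summable (fun i => ‖⟪b i, X (b i)⟫_ℂ‖) :=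
    summable_of_sum_le (fun _ => norm_nonneg _) (h.sum_le b hσ hs)
  refine ⟨h1.of_norm, (norm_tsum_le_tsum_norm h1).trans (h1.tsum_le_of_sum_le (h.sum_le b hσ hs))⟩

end

section
variable {H : Type*} [NormedAddCommGroup H] [InnerProductSpace ℂ H] [CompleteSpace H]

lemma selfadj_approx {C : H →L[ℂ] H} {g : ℕ → ℝ} (hC : Dom C g) (hsa : IsSelfAdjoint C) (n : ℕ) :
    ∃ R, IsSelfAdjoint R ∧ RankLE R (2 * n) ∧ ‖C - R‖ ≤ g n := by
  obtain ⟨R, hR, hn⟩ := hC n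
  refine ⟨(1/2 : ℂ) • (R + star R), ?_, ?_, ?_⟩
  · rw [IsSelfAdjoint, star_smul, star_add, star_star, add_comm]
    simp
  · rw [two_mul]
    exact (hR.add hR.star).smul _
  · have : C - (1/2 : ℂ) • (R + star R) = (1/2 : ℂ) • ((C - R) + star (C - R)) := by
      rw [star_sub, hsa.star_eq]
      module
    rw [this, norm_smul]
    have h2 : ‖C - R + star (C - R)‖ ≤ ‖C - R‖ + ‖C - R‖ := by
      refine (norm_add_le _ _).trans ?_
      rw [norm_star]
    have h3 : ‖(1/2 : ℂ)‖ = 1/2 := by norm_num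
    rw [h3]
    linarith

lemma selfadj_approx' {C : H →L[ℂ] H} {g : ℕ → ℝ} (hC : Dom C g) (hsa : IsSelfAdjoint C) (n : ℕ) :
    ∃ R, IsSelfAdjoint R ∧ RankLE R (2 * n) ∧ Dom (C - R) (fun m => g (max n (m / 4))) := by
  obtain ⟨R, h1, h2, h3⟩ := selfadj_approx hC hsa n
  refine ⟨R, h1, h2, fun m => ?_⟩
  by_cases h : m / 4 ≤ n
  · refine ⟨0, rankLE_zero m, ?_⟩
    simpa [max_eq_left h] using h3
  · obtain ⟨S, _, h5, h6⟩ := selfadj_approx hC hsa (m / 4)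
    refine ⟨S - R, (h5.sub h2).mono (by omega), ?_⟩
    show ‖C - R - (S - R)‖ ≤ g (max n (m / 4))
    rw [max_eq_right (by omega)]
    simpa using h6

lemma summable_div {f : ℕ → ℝ} (h0 : ∀ n, 0 ≤ f n) (hf : Summable f) : Summable (fun m => f (m / 8)) := by
  have h1 : Summable (fun p : ℕ × Fin 8 => f p.1 * (fun _ => (1:ℝ)) p.2) :=
    hf.mul_of_nonneg (g := fun _ : Fin 8 => (1:ℝ)) (Summable.of_finite) h0 (fun _ => zero_le_one)
  have h2 := (Equiv.summable_iff (Nat.divModEquiv 8)).2 h1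
  simpa [Function.comp_def, Nat.divModEquiv] using h2

lemma tannery {φ ψ : ℕ → ℝ} (hφ : Antitone φ) (φ0 : ∀ n, 0 ≤ φ n) (ψ0 : ∀ n, 0 ≤ ψ n)
    (hlim : Tendsto φ atTop (nhds 0)) (hs : Summable (fun n => φ n * ψ n)) :
    (∀ n, Summable (fun m => φ (max n (m / 8)) * ψ (m / 8))) ∧
    Tendsto (fun n => ∑' m, φ (max n (m / 8)) * ψ (m / 8)) atTop (nhds 0) := by
  have hb := summable_div (fun n => mul_nonneg (φ0 n) (ψ0 n)) hs
  have hle : ∀ n m, φ (max n (m / 8)) * ψ (m / 8) ≤ φ (m / 8) * ψ (m / 8) := fun n m =>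
    mul_le_mul_of_nonneg_right (hφ (le_max_right _ _)) (ψ0 _)
  have hnn : ∀ n m, 0 ≤ φ (max n (m / 8)) * ψ (m / 8) := fun n m => mul_nonneg (φ0 _) (ψ0 _)
  refine ⟨fun n => Summable.of_nonneg_of_le (hnn n) (hle n) hb, ?_⟩
  have := tendsto_tsum_of_dominated_convergence (𝓕 := atTop) (f := fun n m => φ (max n (m / 8)) * ψ (m / 8))
    (g := fun _ => (0:ℝ)) hb (by
      intro m
      have h1 : Tendsto (fun n => φ (max n (m / 8))) atTop (nhds 0) :=
        hlim.comp (tendsto_atTop_mono (fun n => le_max_left n (m / 8)) tendsto_id)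
      simpa using h1.mul_const (ψ (m / 8))) (Eventually.of_forall fun n m => by
      rw [Real.norm_of_nonneg (hnn n m)]; exact hle n m)
  simpa using this

lemma spectral_finite {R : H →L[ℂ] H} {r : ℕ} (hR : RankLE R r) (hsa : IsSelfAdjoint R) :
    ∃ (d : ℕ) (e : Fin d → H) (c : Fin d → ℝ), Orthonormal ℂ e ∧
      R = ∑ i, (c i : ℂ) • rankOne (e i) (e i) := by
  obtain ⟨u, v, hRe⟩ := hR
  set S := Submodule.span ℂ (Set.range v)
  have hRS : ∀ x, R x ∈ S := fun x => by
    rw [hRe]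
    simp only [sum_apply, rankOne_apply']
    exact Submodule.sum_mem _ (fun i _ => Submodule.smul_mem _ _ (Submodule.subset_span ⟨i, rfl⟩))
  have hfd : FiniteDimensional ℂ S := FiniteDimensional.span_of_finite ℂ (Set.finite_range v)
  have hsym : ∀ x y, ⟪R x, y⟫_ℂ = ⟪x, R y⟫_ℂ := fun x y => by
    have := ContinuousLinearMap.adjoint_inner_left R y x
    rwa [← ContinuousLinearMap.star_eq_adjoint, hsa.star_eq] at this
  set A : S →ₗ[ℂ] S := (R.toLinearMap.restrict (p := S) (q := S) (fun x _ => hRS x)) with hA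
  have hAx : ∀ x : S, ((A x : S) : H) = R x := fun x => by simp [hA]
  have hAs : A.IsSymmetric := fun x y => by
    rw [Submodule.coe_inner, Submodule.coe_inner, hAx, hAx, hsym]
  set k := hAs.eigenvectorBasis rfl
  set a := hAs.eigenvalues rfl
  have hak : ∀ j, A (k j) = (a j : ℂ) • k j := fun j => hAs.apply_eigenvectorBasis rfl j
  refine ⟨Module.finrank ℂ S, fun i => k i, a, ?_, ?_⟩
  · have := k.orthonormal
    rw [orthonormal_iff_ite] at this ⊢
    simpa using this
  · ext x
    have h1 := congrArg Subtype.val (k.sum_repr ⟨R x, hRS x⟩)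
    simp only [OrthonormalBasis.repr_apply_apply, Submodule.coe_inner] at h1
    rw [← h1, Submodule.coe_sum]
    simp only [Submodule.coe_smul, sum_apply, smul_apply, rankOne_apply']
    apply Finset.sum_congr rfl
    intro i _
    rw [← hsym, ← hAx, hak, Submodule.coe_smul, inner_smul_left, mul_smul]
    simp

lemma hasSum_rankOne (b : HilbertBasis ℕ ℂ H) (u v : H) :
    HasSum (fun i => ⟪b i, rankOne u v (b i)⟫_ℂ) ⟪u, v⟫_ℂ := by
  simpa [inner_smul_right] using b.hasSum_inner_mul_inner u v

lemma hasSum_left (b : HilbertBasis ℕ ℂ H) {d : ℕ} (e : Fin d → H) (c : Fin d → ℝ) (T U : H →L[ℂ] H) :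
    HasSum (fun i => ⟪b i, ((∑ i, (c i : ℂ) • rankOne (e i) (e i)) * star U * T * U) (b i)⟫_ℂ)
      (∑ i, (c i : ℂ) * ⟪U (e i), T (U (e i))⟫_ℂ) := by
  have h := hasSum_sum (s := Finset.univ) (fun (i : Fin d) _ => (hasSum_rankOne b (star (star U * T * U) (e i)) (e i)).mul_left (c i : ℂ))
  convert! h using 1
  · funext j
    simp only [ContinuousLinearMap.mul_apply, sum_apply, smul_apply, rankOne_apply', inner_sum, inner_smul_right]
    apply Finset.sum_congr rfl
    intro i _
    rw [ContinuousLinearMap.star_eq_adjoint (star U * T * U), ContinuousLinearMap.adjoint_inner_left]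
    rfl
  · apply Finset.sum_congr rfl
    intro i _
    rw [ContinuousLinearMap.star_eq_adjoint (star U * T * U), ContinuousLinearMap.adjoint_inner_left]
    simp only [ContinuousLinearMap.mul_apply]
    rw [ContinuousLinearMap.star_eq_adjoint U, ContinuousLinearMap.adjoint_inner_right]

lemma hasSum_right (b : HilbertBasis ℕ ℂ H) {d : ℕ} (e : Fin d → H) (c : Fin d → ℝ) (C U : H →L[ℂ] H) :
    HasSum (fun i => ⟪b i, (C * star U * (∑ i, (c i : ℂ) • rankOne (e i) (e i)) * U) (b i)⟫_ℂ)
      (∑ i, (c i : ℂ) * ⟪star U (e i), C (star U (e i))⟫_ℂ) := by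
  have h := hasSum_sum (s := Finset.univ) (fun (i : Fin d) _ => (hasSum_rankOne b (star U (e i)) (C (star U (e i)))).mul_left (c i : ℂ))
  convert! h using 1
  funext j
  simp only [ContinuousLinearMap.mul_apply, sum_apply, smul_apply, rankOne_apply', inner_sum, inner_smul_right, map_sum, map_smul]
  apply Finset.sum_congr rfl
  intro i _
  rw [ContinuousLinearMap.star_eq_adjoint U, ContinuousLinearMap.adjoint_inner_left]

lemma convex_model {d : ℕ} (e : Fin d → H) (he : Orthonormal ℂ e) (c : Fin d → ℝ) (T : H →L[ℂ] H) :
    Convex ℝ {z | ∃ U ∈ unitary (H →L[ℂ] H), z = ∑ i, (c i : ℂ) * ⟪U (e i), T (U (e i))⟫_ℂ} := by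
  rintro x ⟨U, hU, rfl⟩ y ⟨V, hV, rfl⟩ s t hs ht hst
  have hon : ∀ U ∈ unitary (H →L[ℂ] H), Orthonormal ℂ (fun i => U (e i)) := fun U hU =>
    he.comp_linearIsometryEquiv (Unitary.linearIsometryEquiv ⟨U, hU⟩)
  obtain ⟨f, hf, hs⟩ := on_convex T _ _ (hon U hU) (hon V hV) c s t hs ht hst
  obtain ⟨W, hW, hWe⟩ := exists_unitary e f he hf
  refine ⟨W, hW, ?_⟩
  simp only [hWe, hs, Complex.real_smul]

end

lemma closure_convex (W : Set ℂ) (h : ∀ ε > 0, ∃ W' : Set ℂ, Convex ℝ W' ∧ (∀ z ∈ W, ∃ z' ∈ W', ‖z - z'‖ ≤ ε) ∧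
    (∀ z' ∈ W', ∃ z ∈ W, ‖z - z'‖ ≤ ε)) : Convex ℝ (closure W) := by
  intro x hx y hy s t hs ht hst
  rw [Metric.mem_closure_iff] at hx hy ⊢
  intro ε hε
  obtain ⟨W', hW', h1, h2⟩ := h (ε / 4) (by positivity)
  obtain ⟨x0, hx0, hx⟩ := hx (ε / 4) (by positivity)
  obtain ⟨y0, hy0, hy⟩ := hy (ε / 4) (by positivity)
  obtain ⟨x1, hx1, hx'⟩ := h1 x0 hx0
  obtain ⟨y1, hy1, hy'⟩ := h1 y0 hy0
  obtain ⟨w, hw, hw'⟩ := h2 _ (hW' hx1 hy1 hs ht hst)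
  refine ⟨w, hw, ?_⟩
  rw [dist_eq_norm] at *
  have e : s • x + t • y - w = s • ((x - x0) + (x0 - x1)) + t • ((y - y0) + (y0 - y1)) - (w - (s • x1 + t • y1)) := by
    module
  rw [e]
  have a1 : ‖(x - x0) + (x0 - x1)‖ ≤ ε / 2 := (norm_add_le _ _).trans (by linarith)
  have a2 : ‖(y - y0) + (y0 - y1)‖ ≤ ε / 2 := (norm_add_le _ _).trans (by linarith)
  calc _ ≤ ‖s • ((x - x0) + (x0 - x1))‖ + ‖t • ((y - y0) + (y0 - y1))‖ + ‖w - (s • x1 + t • y1)‖ :=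
        (norm_sub_le _ _).trans (by gcongr; exact norm_add_le _ _)
    _ ≤ s * (ε / 2) + t * (ε / 2) + ε / 4 := by
        rw [norm_smul, norm_smul, Real.norm_of_nonneg hs, Real.norm_of_nonneg ht]
        gcongr
    _ = ε / 2 + ε / 4 := by rw [← add_mul, hst]; ring
    _ < ε := by linarith

section
variable {H : Type*} [NormedAddCommGroup H] [InnerProductSpace ℂ H] [CompleteSpace H]

lemma sig_antitone {φ ψ : ℕ → ℝ} (hφ : Antitone φ) (φ0 : ∀ n, 0 ≤ φ n) (ψ0 : ∀ n, 0 ≤ ψ n)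
    (hψ : Antitone ψ) (n : ℕ) : Antitone (fun m => φ (max n (m / 8)) * ψ (m / 8)) := by
  intro a c h
  have h8 : a / 8 ≤ c / 8 := Nat.div_le_div_right h
  exact mul_le_mul (hφ (max_le_max le_rfl h8)) (hψ h8) (ψ0 _) (φ0 _)

lemma trace_split (b : HilbertBasis ℕ ℂ H) {X Y : H →L[ℂ] H} {z : ℂ} {ε : ℝ}
    (hY : HasSum (fun i => ⟪b i, Y (b i)⟫_ℂ) z)
    (h : Summable (fun i => ⟪b i, (X - Y) (b i)⟫_ℂ) ∧ ‖traceAlong b (X - Y)‖ ≤ ε) :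
    ‖traceAlong b X - z‖ ≤ ε := by
  have : traceAlong b X = traceAlong b (X - Y) + z := by
    unfold traceAlong
    rw [← hY.tsum_eq, ← h.1.tsum_add hY.summable]
    congr 1
    funext i
    rw [← inner_add_right]
    simp
  rw [this]
  simpa using h.2

lemma core_left (b : HilbertBasis ℕ ℂ H) {C T : H →L[ℂ] H} {g h : ℕ → ℝ} (hC : Dom C g) (hT : Dom T h)
    (hg : Antitone g) (hh : Antitone h) (hg0 : Tendsto g atTop (nhds 0))
    (hs : Summable (fun n => g n * h n)) (hsa : IsSelfAdjoint C) :
    Convex ℝ (closure (cNumRange b C T)) := by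
  apply closure_convex
  intro ε hε
  obtain ⟨ht1, ht2⟩ := tannery hg hC.nonneg hT.nonneg hg0 hs
  obtain ⟨n, hn⟩ := ((ht2.eventually (gt_mem_nhds (show (0:ℝ) < ε / 20 by positivity)))).exists
  obtain ⟨R, hR1, hR2, hR3⟩ := selfadj_approx' hC hsa n
  obtain ⟨d, e, c, he, hRe⟩ := spectral_finite hR2 hR1
  have key : ∀ U ∈ unitary (H →L[ℂ] H), ‖traceAlong b (C * star U * T * U) -
      ∑ i, (c i : ℂ) * ⟪U (e i), T (U (e i))⟫_ℂ‖ ≤ ε := by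
    intro U hU
    have h1 := hasSum_left b e c T U
    rw [← hRe] at h1
    refine trace_split b h1 ?_
    have h2 : C * star U * T * U - R * star U * T * U = (C - R) * (star U * T * U) := by noncomm_ring
    rw [h2]
    have h3 : Dom ((C - R) * (star U * T * U)) (fun m => g (max n (m / 8)) * h (m / 8)) := by
      refine (hR3.mul (hT.conj hU)).mono (fun m => ?_)
      have : m / 2 / 4 = m / 8 := by omega
      simp only [this]
      exact mul_le_mul_of_nonneg_left (hh (by omega)) (hC.nonneg _)
    have h4 := h3.summable b (sig_antitone hg hC.nonneg hT.nonneg hh n) (ht1 n)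
    exact ⟨h4.1, h4.2.trans (by linarith)⟩
  refine ⟨_, convex_model e he c T, ?_, ?_⟩
  · rintro z ⟨U, hU, rfl⟩
    exact ⟨_, ⟨U, hU, rfl⟩, key U hU⟩
  · rintro z ⟨U, hU, rfl⟩
    exact ⟨_, ⟨U, hU, rfl⟩, key U hU⟩

lemma core_right (b : HilbertBasis ℕ ℂ H) {C T : H →L[ℂ] H} {g h : ℕ → ℝ} (hC : Dom C g) (hT : Dom T h)
    (hg : Antitone g) (hh : Antitone h) (hh0 : Tendsto h atTop (nhds 0))
    (hs : Summable (fun n => g n * h n)) (hsa : IsSelfAdjoint T) :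
    Convex ℝ (closure (cNumRange b C T)) := by
  apply closure_convex
  intro ε hε
  obtain ⟨ht1, ht2⟩ := tannery hh hT.nonneg hC.nonneg hh0 (by simpa only [mul_comm] using hs)
  obtain ⟨n, hn⟩ := ((ht2.eventually (gt_mem_nhds (show (0:ℝ) < ε / 20 by positivity)))).exists
  obtain ⟨R, hR1, hR2, hR3⟩ := selfadj_approx' hT hsa n
  obtain ⟨d, e, c, he, hRe⟩ := spectral_finite hR2 hR1
  have key : ∀ U ∈ unitary (H →L[ℂ] H), ‖traceAlong b (C * star U * T * U) -
      ∑ i, (c i : ℂ) * ⟪star U (e i), C (star U (e i))⟫_ℂ‖ ≤ ε := by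
    intro U hU
    have h1 := hasSum_right b e c C U
    rw [← hRe] at h1
    refine trace_split b h1 ?_
    have h2 : C * star U * T * U - C * star U * R * U = C * (star U * (T - R) * U) := by noncomm_ring
    rw [h2]
    have h3 : Dom (C * (star U * (T - R) * U)) (fun m => h (max n (m / 8)) * g (m / 8)) := by
      refine (hC.mul (hR3.conj hU)).mono (fun m => ?_)
      have : m / 2 / 4 = m / 8 := by omega
      simp only [this]
      rw [mul_comm]
      exact mul_le_mul_of_nonneg_left (hg (by omega)) (hT.nonneg _)
    have h4 := h3.summable b (sig_antitone hh hT.nonneg hC.nonneg hg n) (ht1 n)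
    exact ⟨h4.1, h4.2.trans (by linarith)⟩
  refine ⟨_, convex_model e he c C, ?_, ?_⟩
  · rintro z ⟨U, hU, rfl⟩
    exact ⟨_, ⟨star U, Unitary.star_mem hU, rfl⟩, key U hU⟩
  · rintro z ⟨U, hU, rfl⟩
    have := key (star U) (Unitary.star_mem hU)
    rw [star_star] at this
    exact ⟨_, ⟨star U, Unitary.star_mem hU, rfl⟩, by rwa [star_star]⟩

lemma convex_scale (d : ℂ) (hd : d ≠ 0) (W W' : Set ℂ) (hW : W' = (fun z => d * z) '' W)
    (h : Convex ℝ (closure W)) : Convex ℝ (closure W') := by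
  have h1 : closure W' = (fun z => d * z) '' closure W := by
    rw [hW]
    exact ((Homeomorph.mulLeft₀ d hd).image_closure W).symm
  rw [h1]
  exact h.linear_image (LinearMap.mulLeft ℝ d)

lemma traceAlong_smul (b : HilbertBasis ℕ ℂ H) (d : ℂ) (A : H →L[ℂ] H) :
    traceAlong b (d • A) = d * traceAlong b A := by
  unfold traceAlong
  rw [← tsum_mul_left]
  simp [inner_smul_right]

lemma cNum_smul_left (b : HilbertBasis ℕ ℂ H) (d : ℂ) (A T : H →L[ℂ] H) :
    cNumRange b (d • A) T = (fun z => d * z) '' cNumRange b A T := by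
  ext z
  constructor
  · rintro ⟨U, hU, rfl⟩
    exact ⟨_, ⟨U, hU, rfl⟩, by simp only [← traceAlong_smul, smul_mul_assoc]⟩
  · rintro ⟨_, ⟨U, hU, rfl⟩, rfl⟩
    exact ⟨U, hU, by simp only [← traceAlong_smul, smul_mul_assoc]⟩

lemma cNum_smul_right (b : HilbertBasis ℕ ℂ H) (d : ℂ) (C A : H →L[ℂ] H) :
    cNumRange b C (d • A) = (fun z => d * z) '' cNumRange b C A := by
  ext z
  constructor
  · rintro ⟨U, hU, rfl⟩
    exact ⟨_, ⟨U, hU, rfl⟩, by simp only [← traceAlong_smul, smul_mul_assoc, mul_smul_comm]⟩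
  · rintro ⟨_, ⟨U, hU, rfl⟩, rfl⟩
    exact ⟨U, hU, by simp only [← traceAlong_smul, smul_mul_assoc, mul_smul_comm]⟩

lemma Dom.smul {X : H →L[ℂ] H} {σ : ℕ → ℝ} (h : Dom X σ) (d : ℂ) : Dom (d • X) (fun n => ‖d‖ * σ n) := by
  intro n
  obtain ⟨R, h1, h2⟩ := h n
  refine ⟨d • R, h1.smul d, ?_⟩
  rw [← smul_sub, norm_smul]
  exact mul_le_mul_of_nonneg_left h2 (norm_nonneg _)

lemma normal_collinear {C : H →L[ℂ] H} (hc : IsCompactOperator C) (hn : IsStarNormal C)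
    (hcol : EigsCollinearThroughOrigin C) : ∃ (d : ℂ) (A : H →L[ℂ] H), d ≠ 0 ∧ IsSelfAdjoint A ∧ C = d • A := by
  obtain ⟨d0, hd0⟩ := hcol
  obtain ⟨d, hd, hcol⟩ : ∃ d : ℂ, d ≠ 0 ∧ ∀ lam : ℂ, (∃ v : H, v ≠ 0 ∧ C v = lam • v) → ∃ t : ℝ, lam = (t : ℂ) * d := by
    by_cases h : d0 = 0
    · refine ⟨1, one_ne_zero, fun lam hl => ?_⟩
      obtain ⟨t, ht⟩ := hd0 lam hl
      exact ⟨0, by simp [ht, h]⟩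
    · exact ⟨d0, h, hd0⟩
  refine ⟨d, d⁻¹ • C, hd, ?_, by rw [smul_inv_smul₀ hd]⟩
  have hn' : IsStarNormal (d⁻¹ • C) := by
    constructor
    rw [star_smul]
    exact (hn.star_comm_self.smul_left _).smul_right _
  have hc' : IsCompactOperator (d⁻¹ • C) := hc.smul d⁻¹
  refine QuasispectrumRestricts.isSelfAdjoint (d⁻¹ • C) ?_
  refine SpectrumRestricts.real_iff.2 ?_
  intro x hx
  by_cases hx0 : x = 0
  · simp [hx0]
  have := (hc'.hasEigenvalue_iff_mem_spectrum hx0).2 hx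
  obtain ⟨v, hv⟩ := this.exists_hasEigenvector
  have h1 : d⁻¹ • C v = x • v := hv.apply_eq_smul
  obtain ⟨t, ht⟩ := hcol (d * x) ⟨v, hv.2, by rw [mul_smul, ← h1, smul_inv_smul₀ hd]⟩
  have : x = t := by
    apply mul_left_cancel₀ hd
    rw [ht, mul_comm]
  rw [this]; simp

end

section
variable {H : Type*} [NormedAddCommGroup H] [InnerProductSpace ℂ H] [CompleteSpace H]

lemma sv_le {T R : H →L[ℂ] H} {n : ℕ} (hR : RankLE R n) : sv T n ≤ ‖T - R‖ := by
  obtain ⟨u, v, rfl⟩ := hR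
  unfold sv
  refine ciInf_le_of_le ⟨0, ?_⟩ u (ciInf_le ⟨0, ?_⟩ v)
  · rintro _ ⟨u, rfl⟩
    exact Real.iInf_nonneg fun _ => norm_nonneg _
  · rintro _ ⟨u, rfl⟩
    exact norm_nonneg _

lemma sv_nonneg (T : H →L[ℂ] H) (n : ℕ) : 0 ≤ sv T n :=
  Real.iInf_nonneg fun _ => Real.iInf_nonneg fun _ => norm_nonneg _

lemma sv_lt {T : H →L[ℂ] H} {n : ℕ} {a : ℝ} (h : sv T n < a) : ∃ R, RankLE R n ∧ ‖T - R‖ < a := by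
  obtain ⟨u, hu⟩ := exists_lt_of_ciInf_lt h
  obtain ⟨v, hv⟩ := exists_lt_of_ciInf_lt hu
  exact ⟨_, ⟨u, v, rfl⟩, hv⟩

lemma sv_antitone (T : H →L[ℂ] H) : Antitone (sv T) := by
  intro n m hnm
  refine le_of_forall_gt fun a ha => ?_
  obtain ⟨R, h1, h2⟩ := sv_lt ha
  exact (sv_le (h1.mono hnm)).trans_lt h2

lemma sv_le_norm (T : H →L[ℂ] H) (n : ℕ) : sv T n ≤ ‖T‖ := by
  simpa using sv_le (T := T) (rankLE_zero n)

lemma compact_approx {T : H →L[ℂ] H} (hT : IsCompactOperator T) {ε : ℝ} (hε : 0 < ε) :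
    ∃ n, sv T n ≤ ε := by
  have h1 := (hT.isCompact_closure_image_closedBall 1).totallyBounded
  rw [Metric.totallyBounded_iff] at h1
  obtain ⟨t, ht, hcov⟩ := h1 ε hε
  set S := Submodule.span ℂ t
  haveI : FiniteDimensional ℂ S := FiniteDimensional.span_of_finite ℂ ht
  set e := stdOrthonormalBasis ℂ S
  refine ⟨Module.finrank ℂ S, ?_⟩
  have hP : RankLE S.starProjection (Module.finrank ℂ S) := by
    refine ⟨fun i => (e i : H), fun i => (e i : H), ?_⟩
    ext x
    rw [Submodule.starProjection_apply, e.orthogonalProjectionOnto_apply_eq_sum]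
    simp
  refine (sv_le (hP.mul_right T)).trans ?_
  refine ContinuousLinearMap.opNorm_le_of_unit_norm hε.le fun x hx => ?_
  have hx' : T x ∈ closure (T '' Metric.closedBall 0 1) :=
    subset_closure ⟨x, by simp [hx], rfl⟩
  obtain ⟨y, hy, hxy⟩ := Set.mem_iUnion₂.1 (hcov hx')
  have h2 : (T - S.starProjection * T) x = T x - S.starProjection (T x) := rfl
  rw [h2, Submodule.starProjection_minimal]
  refine ciInf_le_of_le ⟨0, ?_⟩ ⟨y, Submodule.subset_span hy⟩ ?_
  · rintro _ ⟨u, rfl⟩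
    exact norm_nonneg _
  · rw [Metric.mem_ball, dist_eq_norm] at hxy
    exact hxy.le

lemma sv_tendsto {T : H →L[ℂ] H} (hT : IsCompactOperator T) : Tendsto (sv T) atTop (nhds 0) := by
  rw [Metric.tendsto_atTop]
  intro ε hε
  obtain ⟨n, hn⟩ := compact_approx hT (half_pos hε)
  refine ⟨n, fun m hm => ?_⟩
  rw [Real.dist_eq, sub_zero, abs_of_nonneg (sv_nonneg _ _)]
  linarith [sv_antitone T hm]

lemma summable_sv (p q : ℝ≥0∞) (hpq : 1 / p + 1 / q = 1)
    {C T : H →L[ℂ] H} (hC : MemSchatten p C) (hT : MemSchatten q T) :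
    Summable (fun n => sv C n * sv T n) := by
  haveI : p.HolderConjugate q := ENNReal.holderConjugate_iff.2 (by simpa using hpq)
  haveI : q.HolderConjugate p := ENNReal.holderConjugate_iff.2 (by simpa [add_comm] using hpq)
  by_cases hp : p = ∞
  · have hq : q = 1 := (ENNReal.HolderConjugate.eq_top_iff_eq_one p q).1 hp
    have := hT.2 (by simp [hq])
    simp only [hq, ENNReal.toReal_one, Real.rpow_one] at this
    exact Summable.of_nonneg_of_le (fun n => mul_nonneg (sv_nonneg _ _) (sv_nonneg _ _))
      (fun n => mul_le_mul_of_nonneg_right (sv_le_norm C n) (sv_nonneg _ _)) (this.mul_left _)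
  by_cases hq : q = ∞
  · have hp : p = 1 := (ENNReal.HolderConjugate.eq_top_iff_eq_one q p).1 hq
    have := hC.2 (by simp [hp])
    simp only [hp, ENNReal.toReal_one, Real.rpow_one] at this
    exact Summable.of_nonneg_of_le (fun n => mul_nonneg (sv_nonneg _ _) (sv_nonneg _ _))
      (fun n => mul_le_mul_of_nonneg_left (sv_le_norm T n) (sv_nonneg _ _)) (this.mul_right _)
  exact Real.summable_mul_of_Lp_Lq_of_nonneg (ENNReal.HolderConjugate.toReal_of_ne_top hp hq)
    (sv_nonneg C) (sv_nonneg T) (hC.2 hp) (hT.2 hq)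

noncomputable def svb (C : H →L[ℂ] H) (n : ℕ) : ℝ := sv C n + (1/2 : ℝ) ^ n

lemma dom_svb (C : H →L[ℂ] H) : Dom C (svb C) := fun n => by
  obtain ⟨R, h1, h2⟩ := sv_lt (show sv C n < svb C n from lt_add_of_pos_right _ (by positivity))
  exact ⟨R, h1, h2.le⟩

lemma svb_antitone (C : H →L[ℂ] H) : Antitone (svb C) := fun n m h =>
  add_le_add (sv_antitone C h) (pow_le_pow_of_le_one (by norm_num) (by norm_num) h)

lemma svb_tendsto {T : H →L[ℂ] H} (hT : IsCompactOperator T) : Tendsto (svb T) atTop (nhds 0) := by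
  have h := (sv_tendsto hT).add (tendsto_pow_atTop_nhds_zero_of_lt_one
    (show (0:ℝ) ≤ 1/2 by norm_num) (by norm_num))
  rw [add_zero] at h
  exact h

lemma summable_svb (p q : ℝ≥0∞) (hpq : 1 / p + 1 / q = 1)
    {C T : H →L[ℂ] H} (hC : MemSchatten p C) (hT : MemSchatten q T) :
    Summable (fun n => svb C n * svb T n) := by
  have hg : Summable (fun n : ℕ => (1/2 : ℝ) ^ n) := summable_geometric_two
  refine Summable.of_nonneg_of_le
    (fun n => mul_nonneg ((dom_svb C).nonneg n) ((dom_svb T).nonneg n)) (fun n => ?_)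
    ((summable_sv p q hpq hC hT).add (hg.mul_left (‖C‖ + ‖T‖ + 1)))
  have h0 : (0:ℝ) ≤ (1/2 : ℝ) ^ n := by positivity
  have h1 : (1/2 : ℝ) ^ n ≤ 1 := pow_le_one₀ (by norm_num) (by norm_num)
  have h2 := mul_le_mul_of_nonneg_right (sv_le_norm C n) h0
  have h3 := mul_le_mul_of_nonneg_right (sv_le_norm T n) h0
  have h4 := mul_le_mul_of_nonneg_right h1 h0
  unfold svb
  nlinarith

lemma main_aux (b : HilbertBasis ℕ ℂ H)
    (p q : ℝ≥0∞) (hpq : 1 / p + 1 / q = 1)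
    (C T : H →L[ℂ] H) (hC : MemSchatten p C) (hT : MemSchatten q T)
    (hcol : (IsStarNormal C ∧ EigsCollinearThroughOrigin C) ∨
            (IsStarNormal T ∧ EigsCollinearThroughOrigin T)) :
    Convex ℝ (closure (cNumRange b C T)) := by
  have hs := summable_svb p q hpq hC hT
  have anti : ∀ (X : H →L[ℂ] H) (d : ℂ), Antitone (fun n => ‖d‖ * svb X n) := fun X d n m h =>
    mul_le_mul_of_nonneg_left (svb_antitone X h) (norm_nonneg _)
  rcases hcol with ⟨hn, hc⟩ | ⟨hn, hc⟩
  · obtain ⟨d, A, hd, hA, hCA⟩ := normal_collinear hC.1 hn hc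
    have hdA : Dom A (fun n => ‖d⁻¹‖ * svb C n) := by
      have := (dom_svb C).smul d⁻¹
      have e : d⁻¹ • C = A := by rw [hCA, inv_smul_smul₀ hd]
      rwa [e] at this
    refine convex_scale d hd (cNumRange b A T) _ (by rw [hCA, cNum_smul_left]) ?_
    refine core_left b hdA (dom_svb T) (anti C _) (svb_antitone T) ?_ ?_ hA
    · simpa using (svb_tendsto hC.1).const_mul ‖d⁻¹‖
    · simpa only [mul_assoc] using hs.mul_left ‖d⁻¹‖
  · obtain ⟨d, A, hd, hA, hTA⟩ := normal_collinear hT.1 hn hc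
    have hdA : Dom A (fun n => ‖d⁻¹‖ * svb T n) := by
      have := (dom_svb T).smul d⁻¹
      have e : d⁻¹ • T = A := by rw [hTA, inv_smul_smul₀ hd]
      rwa [e] at this
    refine convex_scale d hd (cNumRange b C A) _ (by rw [hTA, cNum_smul_right]) ?_
    refine core_right b (dom_svb C) hdA (svb_antitone C) (anti T _) ?_ ?_ hA
    · simpa using (svb_tendsto hT.1).const_mul ‖d⁻¹‖
    · simpa only [mul_left_comm] using hs.mul_left ‖d⁻¹‖

end

/-- For conjugate `p, q`, `C ∈ B^p(H)` and `T ∈ B^q(H)`: if `C` is normal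
with eigenvalues on a single line through the origin (or `T` is), then the closure of
`W_C(T)` is convex. -/
theorem stmt_16 {H : Type*} [NormedAddCommGroup H] [InnerProductSpace ℂ H] [CompleteSpace H]
    (b : HilbertBasis ℕ ℂ H)  -- `H` is infinite-dimensional and separable
    (p q : ℝ≥0∞) (hpq : 1 / p + 1 / q = 1)
    (C T : H →L[ℂ] H) (hC : MemSchatten p C) (hT : MemSchatten q T)
    (hcol : (IsStarNormal C ∧ EigsCollinearThroughOrigin C) ∨
            (IsStarNormal T ∧ EigsCollinearThroughOrigin T)) :
    Convex ℝ (closure (cNumRange b C T)) := by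
  exact main_aux b p q hpq C T hC hT hcol
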